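/- Let i, j, k be pairwise distinct vertices of G such that ⟨ij⟩ is not an edge of G and ⟨ik⟩ is an edge of G. Then α_ik(G) > α_ik(G + ⟨ij⟩) if and only if d_kj(G) > 2, and α_ik(G) = α_ik(G + ⟨ij⟩) if and only if d_kj(G) ≤ 2. -/

import Mathlib

open Finset
open scoped Classical

variable {V : Type*} [Fintype V] [DecidableEq V]

/-- Harmonic centrality (closeness) of `u` in `G`:  `Φ_u(G) = ∑_{v ≠ u} 1/d_uv(G)`,
with the convention `1/∞ = 0` (Mathlib's `SimpleGraph.dist` is `0` on unreachable pairs,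
and `(0 : ℝ)⁻¹ = 0`). -/
noncomputable def Phi (G : SimpleGraph V) (u : V) : ℝ :=
  ∑ v ∈ Finset.univ.filter (· ≠ u), ((G.dist u v : ℝ))⁻¹

/-- Local resource availability of `u` from `v` in `G`:
`α_uv(G) = p(1−q)/(d_uv(G)·Φ_v(G))` when `u` and `v` are connected in `G`, else `0`. -/
noncomputable def alpha (p q : ℝ) (G : SimpleGraph V) (u v : V) : ℝ :=
  if G.Reachable u v then p * (1 - q) / ((G.dist u v : ℝ) * Phi G v) else 0

/-- If a potential `f` grows by at most one along each edge, then it grows by at most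
the length along any walk. -/
lemma le_add_length_of_adj {W : Type*} {H : SimpleGraph W} (f : W → ℕ∞)
    (hf : ∀ a b, H.Adj a b → f b ≤ f a + 1) {u v : W} (w : H.Walk u v) :
    f v ≤ f u + w.length := by
  induction w with
  | nil => simp
  | cons h w ih =>
    refine ih.trans ((add_le_add_left (hf _ _ h) _).trans (le_of_eq ?_))
    rw [SimpleGraph.Walk.length_cons]
    push_cast
    ring

lemma edist_le_edist_of_adj_le {W : Type*} {G H : SimpleGraph W} (k : W)
    (hf : ∀ a b, H.Adj a b → G.edist k b ≤ G.edist k a + 1) (v : W) :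
    G.edist k v ≤ H.edist k v := by
  refine le_iInf fun w => ?_
  simpa using le_add_length_of_adj (G.edist k) hf w

/-- Adding an edge between a neighbour of `k` and a vertex within distance two of `k`
does not change distances from `k`. -/
lemma edist_sup_edge_eq {W : Type*} {G : SimpleGraph W} {i j k : W}
    (hik : G.Adj i k) (hkj : G.edist k j ≤ 2) (v : W) :
    (G ⊔ SimpleGraph.edge i j).edist k v = G.edist k v := by
  have hki : G.edist k i = 1 := SimpleGraph.edist_eq_one_iff_adj.mpr hik.symm
  refine le_antisymm (SimpleGraph.edist_anti le_sup_left) (edist_le_edist_of_adj_le k ?_ v)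
  intro a b hab
  rw [SimpleGraph.sup_adj, SimpleGraph.edge_adj] at hab
  rcases hab with hab | ⟨⟨rfl, rfl⟩ | ⟨rfl, rfl⟩, -⟩
  · rw [← SimpleGraph.edist_eq_one_iff_adj.mpr hab]
    exact SimpleGraph.edist_triangle
  · rw [hki]
    exact hkj.trans (by norm_num)
  · rw [hki]
    exact le_add_self

lemma inv_dist_le_inv_dist {W : Type*} {G H : SimpleGraph W} (hGH : G ≤ H) {u v : W}
    (huv : u ≠ v) : ((G.dist u v : ℝ))⁻¹ ≤ ((H.dist u v : ℝ))⁻¹ := by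
  by_cases h : G.Reachable u v
  · have hpos : 0 < H.dist u v := (h.mono hGH).pos_dist_of_ne huv
    have hle : H.dist u v ≤ G.dist u v := h.dist_anti hGH
    gcongr
  · rw [SimpleGraph.dist_eq_zero_of_not_reachable h]
    simp

/-- Adding an edge between a neighbour of `k` and a vertex further than two from `k`
strictly increases the closeness of `k`. -/
lemma Phi_lt_Phi_sup_edge {G : SimpleGraph V} {i j k : V}
    (hij : i ≠ j) (hjk : j ≠ k) (hik : G.Adj i k) (hkj : 2 < G.edist k j) :
    Phi G k < Phi (G ⊔ SimpleGraph.edge i j) k := by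
  refine Finset.sum_lt_sum (fun v hv => inv_dist_le_inv_dist le_sup_left ?_) ⟨j, ?_, ?_⟩
  · exact (by simpa using hv : v ≠ k).symm
  · simpa using hjk
  have hw : (G ⊔ SimpleGraph.edge i j).Adj k i := Or.inl hik.symm
  have hw' : (G ⊔ SimpleGraph.edge i j).Adj i j :=
    Or.inr ((SimpleGraph.edge_adj ..).mpr ⟨Or.inl ⟨rfl, rfl⟩, hij⟩)
  have hle : (G ⊔ SimpleGraph.edge i j).dist k j ≤ 2 :=
    SimpleGraph.dist_le (.cons hw (.cons hw' .nil))
  have hpos : 0 < (G ⊔ SimpleGraph.edge i j).dist k j :=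
    (hw.reachable.trans hw'.reachable).pos_dist_of_ne hjk.symm
  by_cases h : G.Reachable k j
  · have hlt : 2 < G.dist k j := by
      rw [← h.coe_dist_eq_edist] at hkj
      exact_mod_cast hkj
    have hlt' := hle.trans_lt hlt
    gcongr
  · rw [SimpleGraph.dist_eq_zero_of_not_reachable h]
    simpa using hpos

lemma Phi_pos_of_adj {G : SimpleGraph V} {i k : V} (hik : G.Adj i k) : 0 < Phi G k := by
  refine Finset.sum_pos' (fun v _ => by positivity) ⟨i, by simpa using hik.ne, ?_⟩
  rw [SimpleGraph.dist_eq_one_iff_adj.mpr hik.symm]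
  norm_num

lemma alpha_of_adj {p q : ℝ} {G : SimpleGraph V} {i k : V} (hik : G.Adj i k) :
    alpha p q G i k = p * (1 - q) / Phi G k := by
  rw [alpha, if_pos hik.reachable, SimpleGraph.dist_eq_one_iff_adj.mpr hik]
  simp

/-- for `k ∈ η_i(G)` with `⟨ij⟩ ∉ G`:
`α_ik(G) > α_ik(G + ⟨ij⟩)` iff `d_kj(G) > 2`, and
`α_ik(G) = α_ik(G + ⟨ij⟩)` iff `d_kj(G) ≤ 2`. -/
theorem stmt_9 (G : SimpleGraph V) (i j k : V)
    (hij : i ≠ j) (hik : i ≠ k) (hjk : j ≠ k)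
    (hije : ¬ G.Adj i j) (hike : G.Adj i k)
    (p q : ℝ) (hp0 : 0 < p) (hp1 : p < 1) (hq0 : 0 < q) (hq1 : q < 1) :
    (alpha p q G i k > alpha p q (G ⊔ SimpleGraph.edge i j) i k ↔ 2 < G.edist k j) ∧
      (alpha p q G i k = alpha p q (G ⊔ SimpleGraph.edge i j) i k ↔ G.edist k j ≤ 2) := by
  have hike' : (G ⊔ SimpleGraph.edge i j).Adj i k := Or.inl hike
  rw [alpha_of_adj hike, alpha_of_adj hike']
  have heq : G.edist k j ≤ 2 → Phi (G ⊔ SimpleGraph.edge i j) k = Phi G k := fun h =>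
    Finset.sum_congr rfl fun v _ => by
      rw [SimpleGraph.dist, SimpleGraph.dist, edist_sup_edge_eq hike h]
  have hlt : 2 < G.edist k j →
      p * (1 - q) / Phi (G ⊔ SimpleGraph.edge i j) k < p * (1 - q) / Phi G k := fun h =>
    div_lt_div_of_pos_left (mul_pos hp0 (sub_pos.mpr hq1)) (Phi_pos_of_adj hike)
      (Phi_lt_Phi_sup_edge hij hjk hike h)
  refine ⟨⟨fun h => ?_, hlt⟩, fun h => ?_, fun h => by rw [heq h]⟩
  · by_contra! hle
    rw [heq hle] at h
    exact h.false
  · by_contra! hgt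
    exact (hlt hgt).ne' h
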